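/- Let X_1,…,X_n be independent random variables uniformly distributed on [0,1], with n ≥ 2 and 1 ≤ k ≤ n−1. Then the Kozachenko–Leonenko estimator satisfies the exact identity E(Ĥ_n) − H = (k/n)(log 4 − 1) + log(n−1) − Ψ(n), where H = 0 is the entropy of the uniform distribution on [0,1]. -/

import Mathlib

open MeasureTheory Filter

noncomputable section

namespace EntropyKL

/-- Euclidean space `ℝ^d`. -/
abbrev Euc (d : ℕ) := EuclideanSpace ℝ (Fin d)

/-- `V_d`, the volume of the unit ball in `ℝ^d`. -/
def Vd (d : ℕ) : ℝ := Real.pi ^ ((d : ℝ) / 2) / Real.Gamma (1 + (d : ℝ) / 2)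

/-- The digamma function at a positive integer `j`:
`Ψ(j) = -γ_E + ∑_{r=1}^{j-1} 1/r`. -/
def digammaNat (j : ℕ) : ℝ :=
  -Real.eulerMascheroniConstant + ∑ r ∈ Finset.range (j - 1), (1 : ℝ) / (r + 1)

/-- `f` is a probability density (w.r.t. Lebesgue measure) on `ℝ^d`. -/
def IsDensity {d : ℕ} (f : Euc d → ℝ) : Prop :=
  (∀ x, 0 ≤ f x) ∧ Measurable f ∧ (∫ x, f x) = 1

/-- The probability measure with density `f`. -/
def densMeasure {d : ℕ} (f : Euc d → ℝ) : Measure (Euc d) :=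
  (volume : Measure (Euc d)).withDensity fun x => ENNReal.ofReal (f x)

/-- The joint law of `n` i.i.d. observations `X_1, …, X_n` with density `f`. -/
def sampleMeasure {d : ℕ} (f : Euc d → ℝ) (n : ℕ) : Measure (Fin n → Euc d) :=
  Measure.pi fun _ => densMeasure f

/-- The class `𝒜` of decreasing functions `a : (0,∞) → [1,∞)` with
`a(δ) = o(δ^{-ε})` as `δ ↓ 0` for every `ε > 0`. -/
def IsA (a : ℝ → ℝ) : Prop :=
  (∀ δ : ℝ, 0 < δ → 1 ≤ a δ) ∧ (∀ δ₁ δ₂ : ℝ, 0 < δ₁ → δ₁ ≤ δ₂ → a δ₂ ≤ a δ₁) ∧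
    ∀ ε : ℝ, 0 < ε →
      Tendsto (fun δ : ℝ => a δ * δ ^ ε) (nhdsWithin 0 (Set.Ioi 0)) (nhds 0)

/-- The radius `r_a(x) = {8 √d a(f(x))}^{-1/(β ∧ 1)}`. -/
def rA (d : ℕ) (a : ℝ → ℝ) (β : ℝ) (f : Euc d → ℝ) (x : Euc d) : ℝ :=
  (8 * Real.sqrt d * a (f x)) ^ (-(1 / min β 1))

/-- `M_{f,a,β}(x) ≤ bound`, expressed with the denominators cleared.  Here
`m = ⌈β⌉ - 1` and `f^{(t)}` is interpreted via iterated Fréchet derivatives. -/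
def SmoothBoundAt (d : ℕ) (a : ℝ → ℝ) (β : ℝ) (f : Euc d → ℝ) (x : Euc d)
    (bound : ℝ) : Prop :=
  (∀ t : ℕ, 1 ≤ t → t ≤ ⌈β⌉₊ - 1 → ‖iteratedFDeriv ℝ t f x‖ ≤ bound * f x) ∧
    ∀ y : Euc d, 0 < ‖y - x‖ → ‖y - x‖ ≤ rA d a β f x →
      ‖iteratedFDeriv ℝ (⌈β⌉₊ - 1) f y - iteratedFDeriv ℝ (⌈β⌉₊ - 1) f x‖ ≤
        bound * f x * ‖y - x‖ ^ (β - ((⌈β⌉₊ - 1 : ℕ) : ℝ))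

/-- Membership `f ∈ F_{d,θ}` for `θ = (α, β, γ, ν, a)`. -/
structure MemF (d : ℕ) (α β γ ν : ℝ) (a : ℝ → ℝ) (f : Euc d → ℝ) : Prop where
  density : IsDensity f
  moment : (∫ x, ‖x‖ ^ α * f x) ≤ ν
  bdd : ∀ x, f x ≤ γ
  smooth : ContDiff ℝ ((⌈β⌉₊ - 1 : ℕ) : ℕ∞) f
  deriv_bound : ∀ δ : ℝ, 0 < δ → ∀ x, δ ≤ f x → SmoothBoundAt d a β f x (a δ)

/-- `ρ_{(j),i}` : the distance from `X i` to its `j`-th nearest neighbour among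
the other sample points. -/
def nnDist {d n : ℕ} (X : Fin n → Euc d) (i : Fin n) (j : ℕ) : ℝ :=
  (((Finset.univ.erase i).val.map fun l => dist (X i) (X l)).sort (· ≤ ·)).getD (j - 1) 0

/-- `ξ_{(j),i} = e^{-Ψ(j)} V_d (n-1) ρ_{(j),i}^d`. -/
def xi (d : ℕ) {n : ℕ} (X : Fin n → Euc d) (i : Fin n) (j : ℕ) : ℝ :=
  Real.exp (-digammaNat j) * Vd d * ((n : ℝ) - 1) * nnDist X i j ^ d

/-- The (unweighted) Kozachenko–Leonenko estimator with parameter `k`. -/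
def klEstimator (d : ℕ) {n : ℕ} (k : ℕ) (X : Fin n → Euc d) : ℝ :=
  (n : ℝ)⁻¹ * ∑ i, Real.log (xi d X i k)

/-- The weighted Kozachenko–Leonenko estimator `Ĥ_n^w`. -/
def wKL (d : ℕ) {n k : ℕ} (w : Fin k → ℝ) (X : Fin n → Euc d) : ℝ :=
  (n : ℝ)⁻¹ * ∑ i, ∑ j : Fin k, w j * Real.log (xi d X i ((j : ℕ) + 1))

/-- The entropy `H(f) = -∫ f log f`. -/
def Hf {d : ℕ} (f : Euc d → ℝ) : ℝ := -∫ x, f x * Real.log (f x)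

/-- `V(f) = ∫ f log² f - H(f)²`. -/
def Vf {d : ℕ} (f : Euc d → ℝ) : ℝ := (∫ x, f x * Real.log (f x) ^ 2) - Hf f ^ 2

/-- The oracle estimator `H_n^* = -n⁻¹ ∑ log f(X_i)`. -/
def oracle {d n : ℕ} (f : Euc d → ℝ) (X : Fin n → Euc d) : ℝ :=
  -((n : ℝ)⁻¹ * ∑ i, Real.log (f (X i)))

/-- The weight class `W^{(k)}` (weights indexed by `j ∈ {1,…,k}` via `Fin k`). -/
def Wclass (d k : ℕ) (w : Fin k → ℝ) : Prop :=
  (∀ l : ℕ, 1 ≤ l → l ≤ d / 4 →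
      (∑ j : Fin k, w j * (Real.Gamma (((j : ℕ) : ℝ) + 1 + 2 * l / d) /
        Real.Gamma (((j : ℕ) : ℝ) + 1))) = 0) ∧
    ((∑ j : Fin k, w j) = 1) ∧
    ∀ j : Fin k, (¬∃ t : ℕ, 1 ≤ t ∧ t ≤ d ∧ (j : ℕ) + 1 = t * k / d) → w j = 0

/-- Euclidean norm of a weight vector. -/
def wNorm {k : ℕ} (w : Fin k → ℝ) : ℝ := Real.sqrt (∑ j, w j ^ 2)

/-- The bound on `τ₁`. -/
def tau1Bound (d : ℕ) (α β : ℝ) : ℝ :=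
  min (2 * α / (5 * α + 3 * d))
    (min ((α - d) / (2 * α)) (4 * min β 1 / (4 * min β 1 + 3 * d)))

/-- `τ₂ = min(1 - (d/4)/(1 + ⌊d/4⌋), 1 - d/(2β))`. -/
def tau2 (d : ℕ) (β : ℝ) : ℝ :=
  min (1 - ((d : ℝ) / 4) / (1 + ((d / 4 : ℕ) : ℝ))) (1 - (d : ℝ) / (2 * β))

/-- The bounded Lipschitz distance between two measures on `ℝ`. -/
def dBL (P Q : Measure ℝ) : ℝ :=
  sSup {r : ℝ | ∃ h : ℝ → ℝ, (∀ x, |h x| ≤ 1) ∧ (∀ x y, |h x - h y| ≤ |x - y|) ∧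
    r = |(∫ x, h x ∂P) - ∫ x, h x ∂Q|}

/-- `z_q`, the `(1-q)`-quantile of the standard normal distribution. -/
def normalQuantile (q : ℝ) : ℝ :=
  sInf {x : ℝ | 1 - q ≤ (ProbabilityTheory.gaussianReal 0 1 (Set.Iic x)).toReal}

/-- `Ṽ_n^w`. -/
def tildeV (d : ℕ) {n k : ℕ} (w : Fin k → ℝ) (X : Fin n → Euc d) : ℝ :=
  (n : ℝ)⁻¹ * (∑ i, ∑ j : Fin k, w j * Real.log (xi d X i ((j : ℕ) + 1)) ^ 2) -
    wKL d w X ^ 2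

/-- `V̂_n^w = max(Ṽ_n^w, 0)`. -/
def hatV (d : ℕ) {n k : ℕ} (w : Fin k → ℝ) (X : Fin n → Euc d) : ℝ :=
  max (tildeV d w X) 0

/-- Normalising constant `c(t)` of the path `f_{t,g}`. -/
def pathC {d : ℕ} (f g : Euc d → ℝ) (t : ℝ) : ℝ :=
  (∫ x, 2 * f x / (1 + Real.exp (-2 * t * g x)))⁻¹

/-- The path density `f_{t,g}(x) = 2c(t) f(x) / (1 + e^{-2tg(x)})`. -/
def pathDensity {d : ℕ} (f g : Euc d → ℝ) (t : ℝ) (x : Euc d) : ℝ :=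
  2 * pathC f g t * f x / (1 + Real.exp (-2 * t * g x))

/-- The score function `g_λ = λ (log f + H(f))`. -/
def scoreFn {d : ℕ} (f : Euc d → ℝ) (lam : ℝ) (x : Euc d) : ℝ :=
  lam * (Real.log (f x) + Hf f)

/-- The Laplacian `Δf(x) = ∑_j ∂²f/∂x_j²(x)`. -/
def laplacian {d : ℕ} (f : Euc d → ℝ) (x : Euc d) : ℝ :=
  ∑ j : Fin d, iteratedFDeriv ℝ 2 f x fun _ => EuclideanSpace.single j (1 : ℝ)

/-- `h_x(r) = ∫_{B_x(r)} f`. -/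
def hx {d : ℕ} (f : Euc d → ℝ) (x : Euc d) (r : ℝ) : ℝ :=
  ∫ y in Metric.closedBall x r, f y

/-- `h_x^{-1}(s) = inf{r > 0 : h_x(r) ≥ s}`. -/
def hxInv {d : ℕ} (f : Euc d → ℝ) (x : Euc d) (s : ℝ) : ℝ :=
  sInf {r : ℝ | 0 < r ∧ s ≤ hx f x r}

/-- Stirling numbers of the second kind (as reals). -/
def stirling2R (s i : ℕ) : ℝ :=
  ((i.factorial : ℝ))⁻¹ *
    ∑ l ∈ Finset.range (i + 1), (-1 : ℝ) ^ (i - l) * (i.choose l) * (l : ℝ) ^ s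

/-- The Bell numbers (as reals). -/
def bellR (m : ℕ) : ℝ := ∑ i ∈ Finset.range (m + 1), stirling2R m i

/-- The constant `D = 8 √d (71/41)^m m! (m+1)^{m+2}`. -/
def Dconst (d m : ℕ) : ℝ :=
  8 * Real.sqrt d * (71 / 41 : ℝ) ^ m * (m.factorial : ℝ) * ((m : ℝ) + 1) ^ (m + 2)

/-- The constant `C'_m = 2^{4m+9} √d B_m (m+1)^{m+1}`. -/
def CmConst (d m : ℕ) : ℝ :=
  2 ^ (4 * m + 9) * Real.sqrt d * bellR m * ((m : ℝ) + 1) ^ (m + 1)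

/-- `ã(δ) = d^{m/2} C'_m D^m a(δ/4)^{m²+m+1}`. -/
def aTilde (d m : ℕ) (a : ℝ → ℝ) (δ : ℝ) : ℝ :=
  (d : ℝ) ^ ((m : ℝ) / 2) * CmConst d m * Dconst d m ^ m * a (δ / 4) ^ (m ^ 2 + m + 1)

end EntropyKL

namespace EntropyKL

/-- The uniform density on `[0,1] ⊆ ℝ`. -/
def uniform01 : Euc 1 → ℝ := fun x => if x 0 ∈ Set.Icc (0 : ℝ) 1 then 1 else 0


/-- The upper tail `P(Bin(N, p) ≥ k)` as a polynomial in `p`. -/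
def binomTail (N k : ℕ) (p : ℝ) : ℝ :=
  ∑ j ∈ Finset.Icc k N, (N.choose j : ℝ) * p ^ j * (1 - p) ^ (N - j)

lemma continuous_binomTail (N k : ℕ) : Continuous (binomTail N k) := by
  unfold binomTail; fun_prop

lemma binomTail_nonneg (N k : ℕ) {p : ℝ} (h0 : 0 ≤ p) (h1 : p ≤ 1) : 0 ≤ binomTail N k p := by
  have : 0 ≤ 1 - p := by linarith
  exact Finset.sum_nonneg fun j _ => by positivity

lemma binomTail_one {N k : ℕ} (hk : k ≤ N) : binomTail N k 1 = 1 := by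
  unfold binomTail
  rw [Finset.sum_eq_single_of_mem N (by simp [hk])]
  · simp
  · intro j hj hjN
    have : N - j ≠ 0 := by simp only [Finset.mem_Icc] at hj; omega
    simp [this]

lemma integral_pow_mul_one_sub_pow (a b : ℕ) :
    ∫ x in (0 : ℝ)..1, x ^ a * (1 - x) ^ b =
      (a.factorial * b.factorial : ℝ) / (a + b + 1).factorial := by
  induction b generalizing a with
  | zero =>
    simp only [pow_zero, mul_one, integral_pow, Nat.factorial_zero, add_zero, Nat.factorial_succ]
    have := Nat.factorial_ne_zero a
    push_cast
    field_simp
    simp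
  | succ b ih =>
    have hderiv : ∀ x ∈ Set.uIcc (0 : ℝ) 1,
        HasDerivAt (fun x : ℝ => x ^ (a + 1) * (1 - x) ^ (b + 1))
          ((a + 1) * (x ^ a * (1 - x) ^ (b + 1)) - (b + 1) * (x ^ (a + 1) * (1 - x) ^ b)) x := by
      intro x _
      have h1 := hasDerivAt_pow (a + 1) x
      have h2 := ((hasDerivAt_id x).const_sub 1).pow (b + 1)
      refine (h1.mul h2).congr_deriv ?_
      simp only [id, Nat.add_sub_cancel, Pi.pow_apply]
      push_cast
      ring
    have h := intervalIntegral.integral_eq_sub_of_hasDerivAt hderiv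
      (Continuous.intervalIntegrable (by fun_prop) _ _)
    rw [intervalIntegral.integral_sub (Continuous.intervalIntegrable (by fun_prop) _ _)
      (Continuous.intervalIntegrable (by fun_prop) _ _), intervalIntegral.integral_const_mul,
      intervalIntegral.integral_const_mul, ih (a + 1)] at h
    have e : a + 1 + b + 1 = a + (b + 1) + 1 := by ring
    rw [e, Nat.factorial_succ a] at h
    have hF : ((a + (b + 1) + 1).factorial : ℝ) ≠ 0 := by exact_mod_cast Nat.factorial_ne_zero _
    have ha : (a : ℝ) + 1 ≠ 0 := by positivity
    rw [Nat.factorial_succ b]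
    push_cast at h ⊢
    simp only [one_pow, sub_self, ne_eq, Nat.add_eq_zero_iff, one_ne_zero, and_false,
      not_false_eq_true, zero_pow, mul_zero, zero_mul, sub_zero] at h
    rw [eq_div_iff hF]
    refine mul_left_cancel₀ ha ?_
    field_simp at h
    linarith

lemma integral_choose_mul_pow_mul {N j : ℕ} (hj : j ≤ N) :
    ∫ x in (0 : ℝ)..1, (N.choose j : ℝ) * x ^ j * (1 - x) ^ (N - j) = 1 / (N + 1) := by
  simp_rw [mul_assoc]
  rw [intervalIntegral.integral_const_mul, integral_pow_mul_one_sub_pow,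
    Nat.add_sub_cancel' hj, Nat.factorial_succ]
  have h : (N.choose j : ℝ) * j.factorial * (N - j).factorial = N.factorial := by
    exact_mod_cast Nat.choose_mul_factorial_mul_factorial hj
  have hN : (N.factorial : ℝ) ≠ 0 := by exact_mod_cast Nat.factorial_ne_zero _
  push_cast
  rw [← mul_div_assoc, ← mul_assoc, h]
  field_simp

lemma integral_choose_mul_pow_pred_mul {N j : ℕ} (hj0 : 1 ≤ j) (hj : j ≤ N) :
    ∫ x in (0 : ℝ)..1, (N.choose j : ℝ) * x ^ (j - 1) * (1 - x) ^ (N - j) = 1 / j := by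
  simp_rw [mul_assoc]
  obtain ⟨i, rfl⟩ : ∃ i, j = i + 1 := ⟨j - 1, by omega⟩
  have e : i + (N - (i + 1)) + 1 = N := by omega
  rw [intervalIntegral.integral_const_mul, integral_pow_mul_one_sub_pow, Nat.add_sub_cancel, e]
  have h : (N.choose (i + 1) : ℝ) * (i + 1).factorial * (N - (i + 1)).factorial = N.factorial := by
    exact_mod_cast Nat.choose_mul_factorial_mul_factorial hj
  have hN : (N.factorial : ℝ) ≠ 0 := by exact_mod_cast Nat.factorial_ne_zero _
  rw [Nat.factorial_succ] at h
  push_cast at h ⊢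
  have hi : (i : ℝ) + 1 ≠ 0 := by positivity
  field_simp
  linarith

lemma integral_binomTail {N k : ℕ} (hk : k ≤ N) :
    ∫ p in (0 : ℝ)..1, binomTail N k p = 1 - k / (N + 1) := by
  unfold binomTail
  rw [intervalIntegral.integral_finsetSum
    fun j _ => Continuous.intervalIntegrable (by fun_prop) _ _,
    Finset.sum_congr rfl fun j hj => integral_choose_mul_pow_mul (Finset.mem_Icc.1 hj).2]
  have hN : (N : ℝ) + 1 ≠ 0 := by positivity
  simp only [Finset.sum_const, Nat.card_Icc, nsmul_eq_mul]
  rw [Nat.cast_sub (by omega)]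
  push_cast
  field_simp

/-- The quotient `binomTail N k p / p`, for `1 ≤ k`. -/
def binomTailDiv (N k : ℕ) (p : ℝ) : ℝ :=
  ∑ j ∈ Finset.Icc k N, (N.choose j : ℝ) * p ^ (j - 1) * (1 - p) ^ (N - j)

lemma continuous_binomTailDiv (N k : ℕ) : Continuous (binomTailDiv N k) := by
  unfold binomTailDiv; fun_prop

lemma binomTail_eq_mul {N k : ℕ} (hk : 1 ≤ k) (p : ℝ) :
    binomTail N k p = p * binomTailDiv N k p := by
  unfold binomTail binomTailDiv
  rw [Finset.mul_sum]
  refine Finset.sum_congr rfl fun j hj => ?_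
  obtain ⟨i, rfl⟩ : ∃ i, j = i + 1 := ⟨j - 1, by simp only [Finset.mem_Icc] at hj; omega⟩
  rw [Nat.add_sub_cancel, pow_succ]
  ring

lemma integral_binomTailDiv {N k : ℕ} (hk : 1 ≤ k) :
    ∫ p in (0 : ℝ)..1, binomTailDiv N k p = ∑ j ∈ Finset.Icc k N, (1 : ℝ) / j := by
  unfold binomTailDiv
  rw [intervalIntegral.integral_finsetSum
    fun j _ => Continuous.intervalIntegrable (by fun_prop) _ _]
  refine Finset.sum_congr rfl fun j hj => ?_
  rw [Finset.mem_Icc] at hj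
  exact integral_choose_mul_pow_pred_mul (hk.trans hj.1) hj.2

/-- The mass that the uniform law on `[0, 1]` gives to `[t - r, t + r]`. -/
def unifBall (r t : ℝ) : ℝ := min 1 (t + r) - max 0 (t - r)

lemma continuous_unifBall (r : ℝ) : Continuous (unifBall r) := by
  unfold unifBall; fun_prop

lemma integral_comp_unifBall_of_le {B : ℝ → ℝ} (hB : Continuous B) {r : ℝ} (h0 : 0 ≤ r)
    (h1 : r ≤ 1 / 2) :
    ∫ t in (0 : ℝ)..1, B (unifBall r t) =
      (1 - 2 * r) * B (2 * r) + 2 * ((∫ p in (0 : ℝ)..2 * r, B p) - ∫ p in (0 : ℝ)..r, B p) := by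
  have hi : ∀ a b : ℝ, IntervalIntegrable (fun t => B (unifBall r t)) volume a b := fun a b =>
    (hB.comp (continuous_unifBall r)).intervalIntegrable _ _
  rw [← intervalIntegral.integral_add_adjacent_intervals (hi 0 r) (hi r 1),
    ← intervalIntegral.integral_add_adjacent_intervals (hi r (1 - r)) (hi (1 - r) 1)]
  have e1 : ∫ t in (0 : ℝ)..r, B (unifBall r t) = ∫ t in (0 : ℝ)..r, B (t + r) := by
    refine intervalIntegral.integral_congr fun t ht => ?_
    rw [Set.uIcc_of_le h0] at ht
    simp only [unifBall]
    rw [min_eq_right (by linarith [ht.2]), max_eq_left (by linarith [ht.2]), sub_zero]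
  have e2 : ∫ t in r..(1 - r), B (unifBall r t) = ∫ t in r..(1 - r), B (2 * r) := by
    refine intervalIntegral.integral_congr fun t ht => ?_
    rw [Set.uIcc_of_le (by linarith)] at ht
    simp only [unifBall]
    rw [min_eq_right (by linarith [ht.2]), max_eq_right (by linarith [ht.1])]
    congr 1; ring
  have e3 : ∫ t in (1 - r)..1, B (unifBall r t) = ∫ t in (1 - r)..1, B (1 + r - t) := by
    refine intervalIntegral.integral_congr fun t ht => ?_
    rw [Set.uIcc_of_le (by linarith)] at ht
    simp only [unifBall]
    rw [min_eq_left (by linarith [ht.1]), max_eq_right (by linarith [ht.1])]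
    congr 1; ring
  rw [e1, e2, e3, intervalIntegral.integral_comp_add_right, intervalIntegral.integral_const,
    intervalIntegral.integral_comp_sub_left,
    intervalIntegral.integral_interval_sub_left (hB.intervalIntegrable _ _)
      (hB.intervalIntegrable _ _)]
  rw [show 0 + r = r by ring, show r + r = 2 * r by ring, show 1 + r - 1 = r by ring,
    show 1 + r - (1 - r) = 2 * r by ring, smul_eq_mul]
  ring

lemma integral_comp_unifBall_of_ge {B : ℝ → ℝ} (hB : Continuous B) {r : ℝ} (h0 : 1 / 2 ≤ r)
    (h1 : r ≤ 1) :
    ∫ t in (0 : ℝ)..1, B (unifBall r t) =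
      (2 * r - 1) * B 1 + 2 * ((∫ p in (0 : ℝ)..1, B p) - ∫ p in (0 : ℝ)..r, B p) := by
  have hi : ∀ a b : ℝ, IntervalIntegrable (fun t => B (unifBall r t)) volume a b := fun a b =>
    (hB.comp (continuous_unifBall r)).intervalIntegrable _ _
  rw [← intervalIntegral.integral_add_adjacent_intervals (hi 0 (1 - r)) (hi (1 - r) 1),
    ← intervalIntegral.integral_add_adjacent_intervals (hi (1 - r) r) (hi r 1)]
  have e1 : ∫ t in (0 : ℝ)..(1 - r), B (unifBall r t) = ∫ t in (0 : ℝ)..(1 - r), B (t + r) := by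
    refine intervalIntegral.integral_congr fun t ht => ?_
    rw [Set.uIcc_of_le (by linarith)] at ht
    simp only [unifBall]
    rw [min_eq_right (by linarith [ht.2]), max_eq_left (by linarith [ht.2]), sub_zero]
  have e2 : ∫ t in (1 - r)..r, B (unifBall r t) = ∫ t in (1 - r)..r, B 1 := by
    refine intervalIntegral.integral_congr fun t ht => ?_
    rw [Set.uIcc_of_le (by linarith)] at ht
    simp only [unifBall]
    rw [min_eq_left (by linarith [ht.1]), max_eq_left (by linarith [ht.2]), sub_zero]
  have e3 : ∫ t in r..1, B (unifBall r t) = ∫ t in r..1, B (1 + r - t) := by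
    refine intervalIntegral.integral_congr fun t ht => ?_
    rw [Set.uIcc_of_le h1] at ht
    simp only [unifBall]
    rw [min_eq_left (by linarith [ht.1]), max_eq_right (by linarith [ht.1])]
    congr 1; ring
  rw [e1, e2, e3, intervalIntegral.integral_comp_add_right, intervalIntegral.integral_const,
    intervalIntegral.integral_comp_sub_left,
    intervalIntegral.integral_interval_sub_left (hB.intervalIntegrable _ _)
      (hB.intervalIntegrable _ _)]
  rw [show 0 + r = r by ring, show 1 - r + r = 1 by ring, show 1 + r - 1 = r by ring,
    show 1 + r - r = 1 by ring, smul_eq_mul]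
  ring

/-- The mean of `-log` of a distance whose law, given a uniform centre `t`, has distribution
function `r ↦ B (unifBall r t)`. -/
lemma integral_inv_mul_integral_comp_unifBall {B Q : ℝ → ℝ} (hB : Continuous B)
    (hQ : Continuous Q) (hBQ : ∀ p, B p = p * Q p) :
    IntervalIntegrable (fun r => r⁻¹ * ∫ t in (0 : ℝ)..1, B (unifBall r t)) volume 0 1 ∧
    ∫ r in (0 : ℝ)..1, r⁻¹ * ∫ t in (0 : ℝ)..1, B (unifBall r t) =
      (∫ p in (0 : ℝ)..1, Q p) - (∫ p in (0 : ℝ)..1, B p) + B 1 * (1 - Real.log 2) +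
        2 * (∫ p in (0 : ℝ)..1, B p) * Real.log 2 := by
  set R : ℝ → ℝ := fun p => ∫ u in (0 : ℝ)..1, B (p * u) with hR
  have hRc : Continuous R :=
    intervalIntegral.continuous_parametric_intervalIntegral_of_continuous'
      (f := fun p u => B (p * u)) (by
        simp only [Function.uncurry_def]; fun_prop) 0 1
  have hF : ∀ p, ∫ x in (0 : ℝ)..p, B x = p * R p := by
    intro p
    rw [hR, ← smul_eq_mul, intervalIntegral.smul_integral_comp_mul_left]
    simp
  have hiR : ∀ a b : ℝ, IntervalIntegrable R volume a b := hRc.intervalIntegrable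
  have low : Set.EqOn (fun r => r⁻¹ * ∫ t in (0 : ℝ)..1, B (unifBall r t))
      (fun r => 2 * ((1 - 2 * r) * Q (2 * r) + 2 * R (2 * r)) - 2 * R r)
      (Set.uIoc 0 (1 / 2)) := by
    intro r hr
    rw [Set.uIoc_of_le (by norm_num)] at hr
    have : r ≠ 0 := hr.1.ne'
    simp only
    rw [integral_comp_unifBall_of_le hB hr.1.le hr.2, hF, hF, hBQ]
    field_simp
    ring
  have high : Set.EqOn (fun r => r⁻¹ * ∫ t in (0 : ℝ)..1, B (unifBall r t))
      (fun r => 2 * B 1 + (2 * (∫ p in (0 : ℝ)..1, B p) - B 1) * r⁻¹ - 2 * R r)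
      (Set.uIoc (1 / 2) 1) := by
    intro r hr
    rw [Set.uIoc_of_le (by norm_num)] at hr
    have : r ≠ 0 := by linarith [hr.1]
    simp only
    rw [integral_comp_unifBall_of_ge hB hr.1.le hr.2, hF r]
    field_simp
    ring
  have hinv : IntervalIntegrable (fun r : ℝ => r⁻¹) volume (1 / 2) 1 := by
    refine ContinuousOn.intervalIntegrable fun x hx => ?_
    rw [Set.uIcc_of_le (by norm_num)] at hx
    exact (continuousAt_inv₀ (by linarith [hx.1])).continuousWithinAt
  have ilow : IntervalIntegrable (fun r => r⁻¹ * ∫ t in (0 : ℝ)..1, B (unifBall r t))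
      volume 0 (1 / 2) := by
    refine IntervalIntegrable.congr low.symm (Continuous.intervalIntegrable ?_ _ _)
    fun_prop
  have i1 : IntervalIntegrable
      (fun r => 2 * B 1 + (2 * (∫ p in (0 : ℝ)..1, B p) - B 1) * r⁻¹) volume (1 / 2) 1 :=
    intervalIntegrable_const.add (hinv.const_mul _)
  have ihigh : IntervalIntegrable (fun r => r⁻¹ * ∫ t in (0 : ℝ)..1, B (unifBall r t))
      volume (1 / 2) 1 :=
    IntervalIntegrable.congr high.symm (i1.sub ((hiR _ _).const_mul 2))
  refine ⟨ilow.trans ihigh, ?_⟩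
  rw [← intervalIntegral.integral_add_adjacent_intervals ilow ihigh,
    intervalIntegral.integral_congr_ae (ae_of_all _ fun r hr => low hr),
    intervalIntegral.integral_congr_ae (ae_of_all _ fun r hr => high hr)]
  rw [intervalIntegral.integral_sub (Continuous.intervalIntegrable (by fun_prop) _ _)
    (Continuous.intervalIntegrable (by fun_prop) _ _),
    intervalIntegral.integral_sub i1 ((hiR _ _).const_mul 2),
    intervalIntegral.integral_add intervalIntegrable_const (hinv.const_mul _)]
  simp only [intervalIntegral.integral_const_mul, intervalIntegral.integral_const]
  have hc : (2 : ℝ) * ∫ r in (0 : ℝ)..(1 / 2), ((1 - 2 * r) * Q (2 * r) + 2 * R (2 * r)) =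
      (∫ p in (0 : ℝ)..1, Q p) - (∫ p in (0 : ℝ)..1, B p) + 2 * ∫ p in (0 : ℝ)..1, R p := by
    have := intervalIntegral.smul_integral_comp_mul_left (a := 0) (b := 1 / 2)
      (fun u => (1 - u) * Q u + 2 * R u) 2
    rw [smul_eq_mul] at this
    rw [this, mul_zero, show (2 : ℝ) * (1 / 2) = 1 by norm_num,
      ← intervalIntegral.integral_sub (hQ.intervalIntegrable _ _) (hB.intervalIntegrable _ _),
      ← intervalIntegral.integral_const_mul,
      ← intervalIntegral.integral_add (Continuous.intervalIntegrable (by fun_prop) _ _)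
        (Continuous.intervalIntegrable (by fun_prop) _ _)]
    refine intervalIntegral.integral_congr fun u _ => ?_
    simp only [hBQ]
    ring
  rw [hc, integral_inv_of_pos (by norm_num) (by norm_num),
    ← intervalIntegral.integral_add_adjacent_intervals (hiR 0 (1 / 2)) (hiR (1 / 2) 1)]
  norm_num
  ring

lemma getD_lt_iff_le_countP {l : List ℝ} (hl : l.Pairwise (· ≤ ·)) (r : ℝ) {m : ℕ}
    (hm : m < l.length) : l.getD m 0 < r ↔ m + 1 ≤ l.countP (· < r) := by
  induction l generalizing m with
  | nil => simp at hm
  | cons a t ih =>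
    rw [List.pairwise_cons] at hl
    have hzero : ¬ a < r → t.countP (· < r) = 0 := by
      intro h
      rw [List.countP_eq_zero]
      intro b hb
      have := hl.1 b hb
      simp only [decide_eq_true_eq, not_lt]
      linarith
    rw [List.countP_cons]
    cases m with
    | zero => by_cases h : a < r <;> simp [h, hzero]
    | succ m =>
      have hm' : m < t.length := by simpa using hm
      rw [List.getD_cons_succ, ih hl.2 hm']
      by_cases h : a < r
      · simp [h]
      · simp [h, hzero h]

lemma nnDist_lt_iff {d N : ℕ} (X : Fin (N + 1) → Euc d) (i : Fin (N + 1)) {k : ℕ} (hk : 1 ≤ k)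
    (hkN : k ≤ N) (r : ℝ) :
    nnDist X i k < r ↔
      k ≤ (Finset.univ.filter fun l : Fin N => dist (X (i.succAbove l)) (X i) < r).card := by
  unfold nnDist
  have hs : (Finset.univ.erase i).val.map (fun l => dist (X i) (X l)) =
      (Finset.univ : Finset (Fin N)).val.map fun l => dist (X i) (X (i.succAbove l)) := by
    rw [Fin.univ_succAbove N i, Finset.erase_cons, Finset.map_val, Multiset.map_map]
    rfl
  rw [hs, getD_lt_iff_le_countP (Multiset.pairwise_sort _ _) r (by simp; omega),
    Nat.sub_add_cancel hk, ← Multiset.coe_countP, Multiset.sort_eq, Multiset.countP_map,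
    Finset.card_def, Finset.filter_val]
  simp only [dist_comm]

lemma measurableSet_nnDist_lt {d N : ℕ} {k : ℕ} (hk : 1 ≤ k) (hkN : k ≤ N) (i : Fin (N + 1)) :
    MeasurableSet {q : (Fin (N + 1) → Euc d) × ℝ | nnDist q.1 i k < q.2} := by
  have : {q : (Fin (N + 1) → Euc d) × ℝ | nnDist q.1 i k < q.2} =
      {q | k ≤ ∑ l : Fin N, if dist (q.1 (i.succAbove l)) (q.1 i) < q.2 then 1 else 0} := by
    ext q
    simp only [Set.mem_ofPred_eq]
    rw [nnDist_lt_iff q.1 i hk hkN, Finset.card_filter]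
  rw [this]
  refine measurableSet_le measurable_const (Finset.measurable_fun_sum _ fun l _ => ?_)
  refine Measurable.ite (measurableSet_lt ?_ measurable_snd) measurable_const measurable_const
  exact ((measurable_pi_apply _).comp measurable_fst).dist
    ((measurable_pi_apply _).comp measurable_fst)

lemma measurable_nnDist {d N : ℕ} {k : ℕ} (hk : 1 ≤ k) (hkN : k ≤ N) (i : Fin (N + 1)) :
    Measurable fun X : Fin (N + 1) → Euc d => nnDist X i k :=
  measurable_of_Iio fun r =>
    measurable_prodMk_right (y := r) (measurableSet_nnDist_lt hk hkN i)

open Classical in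
lemma pi_card_filter_mem_ge {E : Type*} [MeasurableSpace E] (ν : Measure E)
    [IsProbabilityMeasure ν] {A : Set E} (hA : MeasurableSet A) (N k : ℕ) {p : ℝ}
    (h0 : 0 ≤ p) (h1 : p ≤ 1) (hp : ν A = ENNReal.ofReal p) :
    Measure.pi (fun _ : Fin N => ν)
      {Y | k ≤ (Finset.univ.filter fun l : Fin N => Y l ∈ A).card} =
      ENNReal.ofReal (binomTail N k p) := by
  have hq : 0 ≤ 1 - p := by linarith
  have hAc : ν Aᶜ = ENNReal.ofReal (1 - p) := by
    rw [prob_compl_eq_one_sub hA, hp, ENNReal.ofReal_sub _ h0, ENNReal.ofReal_one]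
  let C : Finset (Fin N) → Set (Fin N → E) := fun S => Set.univ.pi fun l => if l ∈ S then A else Aᶜ
  have hC : ∀ S Y, Y ∈ C S ↔ (Finset.univ.filter fun l : Fin N => Y l ∈ A) = S := by
    intro S Y
    simp only [C, Set.mem_pi, Set.mem_univ, forall_true_left, Finset.ext_iff, Finset.mem_filter,
      Finset.mem_univ, true_and]
    refine forall_congr' fun l => ?_
    by_cases h : l ∈ S <;> simp [h]
  have hunion : {Y : Fin N → E | k ≤ (Finset.univ.filter fun l : Fin N => Y l ∈ A).card} =
      ⋃ S ∈ (Finset.univ : Finset (Finset (Fin N))).filter (fun S => k ≤ S.card), C S := by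
    ext Y
    simp only [Set.mem_ofPred_eq, Set.mem_iUnion, Finset.mem_filter, Finset.mem_univ, true_and, hC,
      exists_prop, exists_eq_right']
  have hCm : ∀ S, MeasurableSet (C S) := fun S =>
    MeasurableSet.univ_pi fun l => by split_ifs <;> simp [hA]
  have hCμ : ∀ S, Measure.pi (fun _ : Fin N => ν) (C S) =
      ENNReal.ofReal (p ^ S.card * (1 - p) ^ (N - S.card)) := by
    intro S
    rw [Measure.pi_pi]
    have : ∀ l : Fin N, ν (if l ∈ S then A else Aᶜ) =
        if l ∈ S then ENNReal.ofReal p else ENNReal.ofReal (1 - p) := by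
      intro l; split_ifs <;> simp [hp, hAc]
    simp_rw [this]
    rw [Finset.prod_ite, Finset.prod_const, Finset.prod_const, Finset.filter_mem_eq_inter,
      Finset.univ_inter, Finset.filter_not, Finset.filter_mem_eq_inter, Finset.univ_inter,
      ← Finset.compl_eq_univ_sdiff, Finset.card_compl, Fintype.card_fin,
      ENNReal.ofReal_mul (by positivity), ENNReal.ofReal_pow h0, ENNReal.ofReal_pow hq]
  rw [hunion, measure_biUnion_finset _ fun S _ => hCm S]
  · simp_rw [hCμ]
    rw [← ENNReal.ofReal_sum_of_nonneg fun S _ => by positivity]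
    congr 1
    rw [Finset.sum_filter, ← Finset.powerset_univ, Finset.sum_powerset_apply_card
      (fun j => if k ≤ j then p ^ j * (1 - p) ^ (N - j) else 0), Finset.card_univ,
      Fintype.card_fin, binomTail]
    simp_rw [smul_ite, smul_zero]
    rw [← Finset.sum_filter]
    refine Finset.sum_congr ?_ fun j _ => by rw [nsmul_eq_mul, mul_assoc]
    ext j
    simp only [Finset.mem_filter, Finset.mem_range, Finset.mem_Icc]
    omega
  · intro S _ T _ hST
    refine Set.disjoint_left.2 fun Y hS hT => hST ?_
    rw [← (hC S Y).1 hS, ← (hC T Y).1 hT]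

lemma pi_nnDist_lt {d N : ℕ} (ν : Measure (Euc d)) [IsProbabilityMeasure ν] {k : ℕ} (hk : 1 ≤ k)
    (hkN : k ≤ N) (i : Fin (N + 1)) (r : ℝ) :
    Measure.pi (fun _ : Fin (N + 1) => ν) {X | nnDist X i k < r} =
      ∫⁻ x, ENNReal.ofReal (binomTail N k (ν (Metric.ball x r)).toReal) ∂ν := by
  have hmp := (measurePreserving_piFinSuccAbove (fun _ : Fin (N + 1) => ν) i).symm
  have hmeas : MeasurableSet {X : Fin (N + 1) → Euc d | nnDist X i k < r} :=
    measurableSet_lt (measurable_nnDist hk hkN i) measurable_const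
  rw [← hmp.measure_preimage hmeas.nullMeasurableSet,
    Measure.prod_apply (hmp.measurable hmeas)]
  refine lintegral_congr fun x => ?_
  rw [← pi_card_filter_mem_ge ν (measurableSet_ball (x := x) (ε := r)) N k ENNReal.toReal_nonneg
    (ENNReal.toReal_le_of_le_ofReal zero_le_one (by simpa using prob_le_one))
    (ENNReal.ofReal_toReal (measure_ne_top _ _)).symm]
  congr 1
  ext Y
  have he : (MeasurableEquiv.piFinSuccAbove (fun _ => Euc d) i).symm (x, Y) =
      i.insertNth (α := fun _ => Euc d) x Y := rfl
  simp only [Set.mem_preimage, Set.mem_ofPred_eq]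
  rw [nnDist_lt_iff _ i hk hkN, he]
  simp only [Fin.insertNth_apply_succAbove, Fin.insertNth_apply_same, Metric.mem_ball]

lemma sum_Icc_one_div_eq_digammaNat_sub {N k : ℕ} (hk : 1 ≤ k) (hkN : k ≤ N) :
    ∑ j ∈ Finset.Icc k N, (1 : ℝ) / j = digammaNat (N + 1) - digammaNat k := by
  obtain ⟨m, rfl⟩ : ∃ m, k = m + 1 := ⟨k - 1, by omega⟩
  unfold digammaNat
  simp only [Nat.add_sub_cancel]
  rw [← Finset.sum_range_add_sum_Ico (fun r : ℕ => (1 : ℝ) / (r + 1)) (show m ≤ N by omega)]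
  have h := Finset.sum_Ico_add' (fun j : ℕ => (1 : ℝ) / j) m N 1
  push_cast at h
  rw [h, Finset.Ico_add_one_right_eq_Icc]
  ring

lemma Vd_one : Vd 1 = 2 := by
  have h : Real.Gamma (1 + (1 : ℝ) / 2) = 1 / 2 * Real.sqrt Real.pi := by
    rw [add_comm, Real.Gamma_add_one (by norm_num), Real.Gamma_one_half_eq]
  have hpi : Real.sqrt Real.pi ≠ 0 := (Real.sqrt_pos.2 Real.pi_pos).ne'
  rw [Vd, Nat.cast_one, h, ← Real.sqrt_eq_rpow]
  field_simp

lemma Hf_uniform01 : Hf uniform01 = 0 := by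
  have : ∀ x, uniform01 x * Real.log (uniform01 x) = 0 := fun x => by
    unfold uniform01; split_ifs <;> simp
  simp [Hf, this]

lemma measurePreserving_eval_zero :
    MeasurePreserving (fun x : Euc 1 => x 0) volume volume :=
  (volume_preserving_funUnique (Fin 1) ℝ).comp
    (EuclideanSpace.volume_preserving_symm_measurableEquiv_toLp (Fin 1))

lemma measurePreserving_eval_zero_uniform01 :
    MeasurePreserving (fun x : Euc 1 => x 0) (densMeasure uniform01)
      (volume.restrict (Set.Icc 0 1)) := by
  have h := measurePreserving_eval_zero.restrict_preimage (s := Set.Icc (0 : ℝ) 1)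
    measurableSet_Icc
  suffices hd : densMeasure uniform01 =
      volume.restrict ((fun x : Euc 1 => x 0) ⁻¹' Set.Icc (0 : ℝ) 1) by rwa [hd]
  rw [densMeasure, ← withDensity_indicator_one
    (measurePreserving_eval_zero.measurable measurableSet_Icc)]
  congr 1
  ext x
  by_cases hx : x 0 ∈ Set.Icc (0 : ℝ) 1
  · rw [Set.indicator_of_mem (by exact hx), uniform01, if_pos hx]; simp
  · rw [Set.indicator_of_notMem (by exact hx), uniform01, if_neg hx]; simp

instance isProbabilityMeasure_uniform01 : IsProbabilityMeasure (densMeasure uniform01) := by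
  constructor
  have h := measurePreserving_eval_zero_uniform01.measure_preimage
    (MeasurableSet.univ.nullMeasurableSet)
  rw [Set.preimage_univ] at h
  simp [h]

lemma densMeasure_uniform01_ball {x : Euc 1} (hx : x 0 ∈ Set.Icc (0 : ℝ) 1) {r : ℝ}
    (hr : 0 ≤ r) :
    (densMeasure uniform01 (Metric.ball x r)).toReal = unifBall r (x 0) := by
  have hball : Metric.ball x r = (fun y : Euc 1 => y 0) ⁻¹' Metric.ball (x 0) r := by
    ext y
    simp [EuclideanSpace.dist_eq, Real.sqrt_sq dist_nonneg]
  rw [hball, measurePreserving_eval_zero_uniform01.measure_preimage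
    measurableSet_ball.nullMeasurableSet, Measure.restrict_apply measurableSet_ball,
    Real.ball_eq_Ioo, measure_congr (Ioo_ae_eq_Icc.inter (ae_eq_refl (Set.Icc (0 : ℝ) 1))),
    Set.Icc_inter_Icc, Real.volume_Icc]
  have h : (x 0 + r) ⊓ 1 - (x 0 - r) ⊔ 0 = unifBall r (x 0) := by
    simp only [unifBall, min_comm, max_comm]
  rw [h, ENNReal.toReal_ofReal]
  rw [unifBall, sub_nonneg, le_min_iff, max_le_iff, max_le_iff]
  exact ⟨⟨zero_le_one, by linarith [hx.2]⟩, by linarith [hx.1], by linarith⟩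

lemma unifBall_mem {r t : ℝ} (hr : 0 ≤ r) (ht : t ∈ Set.Icc (0 : ℝ) 1) :
    0 ≤ unifBall r t ∧ unifBall r t ≤ 1 := by
  rw [← show (!₂[t] : Euc 1) 0 = t from rfl, ← densMeasure_uniform01_ball ht hr]
  exact ⟨ENNReal.toReal_nonneg,
    ENNReal.toReal_le_of_le_ofReal zero_le_one (by simpa using prob_le_one)⟩

instance isProbabilityMeasure_sampleMeasure_uniform01 (n : ℕ) :
    IsProbabilityMeasure (sampleMeasure uniform01 n) := by
  unfold sampleMeasure; infer_instance

lemma integral_binomTail_unifBall_nonneg (N k : ℕ) {r : ℝ} (hr : 0 ≤ r) :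
    0 ≤ ∫ t in (0 : ℝ)..1, binomTail N k (unifBall r t) :=
  intervalIntegral.integral_nonneg zero_le_one fun _ ht =>
    binomTail_nonneg N k (unifBall_mem hr ht).1 (unifBall_mem hr ht).2

lemma sampleMeasure_nnDist_lt {N k : ℕ} (hk : 1 ≤ k) (hkN : k ≤ N) (i : Fin (N + 1)) {r : ℝ}
    (hr : 0 ≤ r) :
    sampleMeasure uniform01 (N + 1) {X | nnDist X i k < r} =
      ENNReal.ofReal (∫ t in (0 : ℝ)..1, binomTail N k (unifBall r t)) := by
  have hc : Continuous fun t => binomTail N k (unifBall r t) :=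
    (continuous_binomTail N k).comp (continuous_unifBall r)
  have hae : ∀ᵐ x ∂densMeasure uniform01, x 0 ∈ Set.Icc (0 : ℝ) 1 :=
    measurePreserving_eval_zero_uniform01.quasiMeasurePreserving.ae
      (ae_restrict_mem measurableSet_Icc)
  rw [sampleMeasure, pi_nnDist_lt _ hk hkN,
    lintegral_congr_ae (hae.mono fun x hx => by
      simp only [densMeasure_uniform01_ball hx hr]; rfl),
    measurePreserving_eval_zero_uniform01.lintegral_comp
      (f := fun t => ENNReal.ofReal (binomTail N k (unifBall r t))) hc.measurable.ennreal_ofReal,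
    intervalIntegral.integral_of_le zero_le_one, ← integral_Icc_eq_integral_Ioc,
    ofReal_integral_eq_lintegral_ofReal (hc.integrableOn_Icc)]
  filter_upwards [ae_restrict_mem measurableSet_Icc] with t ht
  exact binomTail_nonneg N k (unifBall_mem hr ht).1 (unifBall_mem hr ht).2

lemma ae_nnDist_lt_one {N k : ℕ} (hk : 1 ≤ k) (hkN : k ≤ N) (i : Fin (N + 1)) :
    ∀ᵐ X ∂sampleMeasure uniform01 (N + 1), nnDist X i k < 1 := by
  have hm : MeasurableSet {X : Fin (N + 1) → Euc 1 | nnDist X i k < 1} :=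
    measurableSet_lt (measurable_nnDist hk hkN i) measurable_const
  refine (prob_compl_eq_zero_iff hm).2 ?_
  rw [sampleMeasure_nnDist_lt hk hkN i zero_le_one,
    integral_comp_unifBall_of_ge (continuous_binomTail N k) (by norm_num) le_rfl,
    binomTail_one hkN]
  norm_num

/-- For `0 < a ≤ 1` this is `-log a`, written as a lower integral; for `a ≤ 0` it is `∞`. -/
def invTail (a : ℝ) : ENNReal :=
  ∫⁻ r in Set.Ioo (0 : ℝ) 1, (Set.Ioi a).indicator (fun r => ENNReal.ofReal r⁻¹) r

lemma invTail_of_pos {a : ℝ} (h0 : 0 < a) (h1 : a ≤ 1) :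
    invTail a = ENNReal.ofReal (-Real.log a) := by
  have hint : IntervalIntegrable (fun r : ℝ => r⁻¹) volume a 1 := by
    refine ContinuousOn.intervalIntegrable fun x hx => ?_
    rw [Set.uIcc_of_le h1] at hx
    exact (continuousAt_inv₀ (by linarith [hx.1])).continuousWithinAt
  rw [invTail, lintegral_indicator measurableSet_Ioi, Measure.restrict_restrict measurableSet_Ioi,
    Set.inter_comm, Set.Ioo_inter_Ioi, max_eq_right h0.le, ← Real.log_inv, ← one_div,
    ← integral_inv_of_pos h0 one_pos, intervalIntegral.integral_of_le h1,
    integral_Ioc_eq_integral_Ioo, ofReal_integral_eq_lintegral_ofReal]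
  · exact (intervalIntegrable_iff_integrableOn_Ioo_of_le h1).1 hint
  · filter_upwards [ae_restrict_mem measurableSet_Ioo] with r hr
    exact inv_nonneg.2 (h0.trans hr.1).le

lemma invTail_of_nonpos {a : ℝ} (ha : a ≤ 0) : invTail a = ⊤ := by
  rw [invTail, lintegral_indicator measurableSet_Ioi, Measure.restrict_restrict measurableSet_Ioi,
    Set.inter_comm, Set.Ioo_inter_Ioi, max_eq_left ha]
  by_contra h
  have hi : IntegrableOn (fun r : ℝ => r⁻¹) (Set.Ioo 0 1) := by
    refine (lintegral_ofReal_ne_top_iff_integrable measurable_inv.aestronglyMeasurable ?_).1 h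
    filter_upwards [ae_restrict_mem measurableSet_Ioo] with r hr
    exact inv_nonneg.2 hr.1.le
  have := (intervalIntegrable_iff_integrableOn_Ioo_of_le zero_le_one).2 hi
  rw [intervalIntegrable_inv_iff] at this
  simp at this

/-- The mean of `-log ρ_{(k),i}` for `N + 1` uniform observations. -/
def meanNegLog (N k : ℕ) : ℝ :=
  ∫ r in (0 : ℝ)..1, r⁻¹ * ∫ t in (0 : ℝ)..1, binomTail N k (unifBall r t)

lemma meanNegLog_eq {N k : ℕ} (hk : 1 ≤ k) (hkN : k ≤ N) :
    meanNegLog N k = digammaNat (N + 1) - digammaNat k + k / (N + 1) + Real.log 2 -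
      2 * k / (N + 1) * Real.log 2 := by
  rw [meanNegLog, (integral_inv_mul_integral_comp_unifBall (continuous_binomTail N k)
    (continuous_binomTailDiv N k) (binomTail_eq_mul hk)).2, integral_binomTailDiv hk,
    integral_binomTail hkN, binomTail_one hkN, sum_Icc_one_div_eq_digammaNat_sub hk hkN]
  ring

lemma meanNegLog_nonneg (N k : ℕ) : 0 ≤ meanNegLog N k :=
  intervalIntegral.integral_nonneg zero_le_one fun _ hr =>
    mul_nonneg (inv_nonneg.2 hr.1) (integral_binomTail_unifBall_nonneg N k hr.1)

lemma measurable_invTail_nnDist_kernel {N k : ℕ} (hk : 1 ≤ k) (hkN : k ≤ N) (i : Fin (N + 1)) :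
    Measurable (Function.uncurry fun (X : Fin (N + 1) → Euc 1) (r : ℝ) =>
      (Set.Ioi (nnDist X i k)).indicator (fun r => ENNReal.ofReal r⁻¹) r) :=
  Measurable.ite (measurableSet_nnDist_lt hk hkN i)
    (measurable_snd.inv.ennreal_ofReal) measurable_const

lemma lintegral_invTail_nnDist {N k : ℕ} (hk : 1 ≤ k) (hkN : k ≤ N) (i : Fin (N + 1)) :
    ∫⁻ X, invTail (nnDist X i k) ∂sampleMeasure uniform01 (N + 1) =
      ENNReal.ofReal (meanNegLog N k) := by
  unfold invTail
  rw [lintegral_lintegral_swap (measurable_invTail_nnDist_kernel hk hkN i).aemeasurable,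
    meanNegLog, intervalIntegral.integral_of_le zero_le_one, integral_Ioc_eq_integral_Ioo,
    ofReal_integral_eq_lintegral_ofReal]
  · refine setLIntegral_congr_fun measurableSet_Ioo fun r hr => ?_
    rw [ENNReal.ofReal_mul (inv_nonneg.2 hr.1.le), ← sampleMeasure_nnDist_lt hk hkN i hr.1.le,
      ← lintegral_indicator_const
        (measurableSet_lt (measurable_nnDist hk hkN i) measurable_const)]
    rfl
  · exact (intervalIntegrable_iff_integrableOn_Ioo_of_le zero_le_one).1
      (integral_inv_mul_integral_comp_unifBall (continuous_binomTail N k)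
        (continuous_binomTailDiv N k) (binomTail_eq_mul hk)).1
  · filter_upwards [ae_restrict_mem measurableSet_Ioo] with r hr
    exact mul_nonneg (inv_nonneg.2 hr.1.le) (integral_binomTail_unifBall_nonneg N k hr.1.le)

lemma ae_nnDist_pos {N k : ℕ} (hk : 1 ≤ k) (hkN : k ≤ N) (i : Fin (N + 1)) :
    ∀ᵐ X ∂sampleMeasure uniform01 (N + 1), 0 < nnDist X i k := by
  have hm : Measurable fun X : Fin (N + 1) → Euc 1 => invTail (nnDist X i k) :=
    (measurable_invTail_nnDist_kernel hk hkN i).lintegral_prod_right'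
  filter_upwards [ae_lt_top hm (by
    rw [lintegral_invTail_nnDist hk hkN]; exact ENNReal.ofReal_ne_top)] with X hX
  by_contra h
  rw [invTail_of_nonpos (not_lt.1 h)] at hX
  exact lt_irrefl _ hX

lemma lintegral_neg_log_nnDist {N k : ℕ} (hk : 1 ≤ k) (hkN : k ≤ N) (i : Fin (N + 1)) :
    ∫⁻ X, ENNReal.ofReal (-Real.log (nnDist X i k)) ∂sampleMeasure uniform01 (N + 1) =
      ENNReal.ofReal (meanNegLog N k) := by
  rw [← lintegral_invTail_nnDist hk hkN i]
  refine lintegral_congr_ae ?_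
  filter_upwards [ae_nnDist_pos hk hkN i, ae_nnDist_lt_one hk hkN i] with X h0 h1
  rw [invTail_of_pos h0 h1.le]

lemma ae_neg_log_nnDist_nonneg {N k : ℕ} (hk : 1 ≤ k) (hkN : k ≤ N) (i : Fin (N + 1)) :
    0 ≤ᵐ[sampleMeasure uniform01 (N + 1)] fun X => -Real.log (nnDist X i k) := by
  filter_upwards [ae_nnDist_pos hk hkN i, ae_nnDist_lt_one hk hkN i] with X h0 h1
  exact neg_nonneg.2 (Real.log_nonpos h0.le h1.le)

lemma integrable_neg_log_nnDist {N k : ℕ} (hk : 1 ≤ k) (hkN : k ≤ N) (i : Fin (N + 1)) :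
    Integrable (fun X => -Real.log (nnDist X i k)) (sampleMeasure uniform01 (N + 1)) := by
  refine (lintegral_ofReal_ne_top_iff_integrable
    (measurable_nnDist hk hkN i).log.neg.aestronglyMeasurable
    (ae_neg_log_nnDist_nonneg hk hkN i)).1 ?_
  exact (lintegral_neg_log_nnDist hk hkN i).trans_ne ENNReal.ofReal_ne_top

lemma integral_neg_log_nnDist {N k : ℕ} (hk : 1 ≤ k) (hkN : k ≤ N) (i : Fin (N + 1)) :
    ∫ X, -Real.log (nnDist X i k) ∂sampleMeasure uniform01 (N + 1) = meanNegLog N k := by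
  rw [integral_eq_lintegral_of_nonneg_ae (ae_neg_log_nnDist_nonneg hk hkN i)
    (measurable_nnDist hk hkN i).log.neg.aestronglyMeasurable, lintegral_neg_log_nnDist hk hkN,
    ENNReal.toReal_ofReal (meanNegLog_nonneg N k)]

lemma ae_log_xi_eq {N k : ℕ} (hk : 1 ≤ k) (hkN : k ≤ N) (i : Fin (N + 1)) :
    (fun X => Real.log (xi 1 X i k)) =ᵐ[sampleMeasure uniform01 (N + 1)] fun X =>
      (-digammaNat k + Real.log 2 + Real.log N) - -Real.log (nnDist X i k) := by
  have hN : (N : ℝ) ≠ 0 := by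
    have : N ≠ 0 := by omega
    exact_mod_cast this
  filter_upwards [ae_nnDist_pos hk hkN i] with X h0
  have e : ((N + 1 : ℕ) : ℝ) - 1 = N := by push_cast; ring
  rw [xi, Vd_one, e, pow_one, Real.log_mul (by positivity) h0.ne', Real.log_mul (by positivity) hN,
    Real.log_mul (by positivity) two_ne_zero, Real.log_exp, sub_neg_eq_add]

lemma integrable_log_xi {N k : ℕ} (hk : 1 ≤ k) (hkN : k ≤ N) (i : Fin (N + 1)) :
    Integrable (fun X => Real.log (xi 1 X i k)) (sampleMeasure uniform01 (N + 1)) :=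
  ((integrable_const _).sub (integrable_neg_log_nnDist hk hkN i)).congr (ae_log_xi_eq hk hkN i).symm

lemma integral_log_xi {N k : ℕ} (hk : 1 ≤ k) (hkN : k ≤ N) (i : Fin (N + 1)) :
    ∫ X, Real.log (xi 1 X i k) ∂sampleMeasure uniform01 (N + 1) =
      -digammaNat k + Real.log 2 + Real.log N - meanNegLog N k := by
  rw [integral_congr_ae (ae_log_xi_eq hk hkN i),
    integral_sub (integrable_const _) (integrable_neg_log_nnDist hk hkN i),
    integral_neg_log_nnDist hk hkN]
  simp

/-- exact bias of the Kozachenko–Leonenko estimator for the `U[0,1]`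
distribution: `E(Ĥ_n) - H = (k/n)(log 4 - 1) + log(n-1) - Ψ(n)`, with `H = 0`. -/
theorem klEstimator_uniform_exact_bias (n k : ℕ) (hn : 2 ≤ n) (hk1 : 1 ≤ k)
    (hkn : k ≤ n - 1) :
    (∫ X, klEstimator 1 k X ∂sampleMeasure uniform01 n) - Hf uniform01 =
      (k : ℝ) / n * (Real.log 4 - 1) + Real.log ((n : ℝ) - 1) - digammaNat n := by
  obtain ⟨N, rfl⟩ : ∃ N, n = N + 1 := ⟨n - 1, by omega⟩
  rw [Nat.add_sub_cancel] at hkn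
  have hlog : Real.log 4 = 2 * Real.log 2 := by
    rw [show (4 : ℝ) = 2 ^ 2 by norm_num, Real.log_pow]
    norm_num
  have hN : (N : ℝ) + 1 ≠ 0 := by positivity
  unfold klEstimator
  rw [Hf_uniform01, sub_zero, integral_const_mul,
    integral_finsetSum _ fun i _ => integrable_log_xi hk1 hkn i,
    Finset.sum_congr rfl fun i _ => integral_log_xi hk1 hkn i, meanNegLog_eq hk1 hkn, hlog]
  simp only [Finset.sum_const, Finset.card_univ, Fintype.card_fin, nsmul_eq_mul]
  push_cast
  rw [add_sub_cancel_right]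
  field_simp
  ring

end EntropyKL
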